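/- Existence for the 1-2 junction: for every choice of initial data φ^1, φ^2, φ^3 ∈ B, continuous boundary data f̄^1 : [0,T] → B and Φ̄^2, Φ̄^3 : [0,T] → [0,1], distribution coefficient a ∈ [0,1], flux limiter Φ and table of games as in the assumptions, there exists a mild kinetic solution F = (f^1,f^2,f^3) : [0,T] → B^3 across the 1-2 junction. -/

import Mathlib

open Set

noncomputable def rhoF {n : ℕ} (f : Fin n → ℝ) : ℝ := ∑ j, f j

noncomputable def fluxF {n : ℕ} (v f : Fin n → ℝ) : ℝ := ∑ j, v j * f j

noncomputable def gainF {n : ℕ} (η0 : ℝ) (A : Fin n → Fin n → Fin n → ℝ → ℝ)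
    (j : Fin n) (f : Fin n → ℝ) : ℝ :=
  η0 * rhoF f * ∑ h, ∑ k, A h k j (rhoF f) * f h * f k

noncomputable def lossF {n : ℕ} (η0 : ℝ) (f : Fin n → ℝ) : ℝ := η0 * (rhoF f) ^ 2

def admissibleF {n : ℕ} (f : Fin n → ℝ) : Prop :=
  (∀ j, 0 ≤ f j ∧ f j ≤ 1) ∧ rhoF f ≤ 1

noncomputable def deltaC {n : ℕ} (j : Fin n) : ℝ := if (j : ℕ) = 0 then 0 else 1

def IsSpeedLattice {n : ℕ} (hn : 2 ≤ n) (v : Fin n → ℝ) : Prop :=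
  StrictMono v ∧ v ⟨0, by omega⟩ = 0 ∧ v ⟨n - 1, by omega⟩ = 1

def IsFluxLimiter (Φ : ℝ → ℝ → ℝ) : Prop :=
  (∀ u ∈ Icc (0:ℝ) 1, ∀ w ∈ Icc (0:ℝ) 1, Φ u w ∈ Icc (0:ℝ) 1) ∧
  (∀ u ∈ Icc (0:ℝ) 1, ∀ w ∈ Icc (0:ℝ) 1, 1 < u + w → Φ u w * u ≤ 1 - w) ∧
  (∃ K : ℝ, 0 < K ∧ ∀ u₁ ∈ Icc (0:ℝ) 1, ∀ w₁ ∈ Icc (0:ℝ) 1, ∀ u₂ ∈ Icc (0:ℝ) 1,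
    ∀ w₂ ∈ Icc (0:ℝ) 1, |Φ u₂ w₂ - Φ u₁ w₁| ≤ K * (|u₂ - u₁| + |w₂ - w₁|))

def IsTableOfGames {n : ℕ} (A : Fin n → Fin n → Fin n → ℝ → ℝ) : Prop :=
  (∀ h k j : Fin n, ∀ u ∈ Icc (0:ℝ) 1, A h k j u ∈ Icc (0:ℝ) 1) ∧
  (∀ h k : Fin n, ∀ u ∈ Icc (0:ℝ) 1, ∑ j, A h k j u = 1) ∧
  (∀ h k j : Fin n, ∃ K : ℝ, 0 < K ∧ ∀ u ∈ Icc (0:ℝ) 1, ∀ w ∈ Icc (0:ℝ) 1,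
    |A h k j u - A h k j w| ≤ K * |u - w|)

noncomputable def rhs1 {n : ℕ} (v : Fin n → ℝ) (η0 : ℝ) (A : Fin n → Fin n → Fin n → ℝ → ℝ)
    (Φ : ℝ → ℝ → ℝ) (a : ℝ) (fbar1 f1 f2 f3 : ℝ → Fin n → ℝ) (j : Fin n) (s : ℝ) : ℝ :=
  v j * (Φ (∑ k, fbar1 s k) (rhoF (f1 s)) * fbar1 s j
    - (a * Φ (a * ∑ k, deltaC k * f1 s k) (rhoF (f2 s))
      + (1 - a) * Φ ((1 - a) * ∑ k, deltaC k * f1 s k) (rhoF (f3 s))) * f1 s j)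
  + gainF η0 A j (f1 s) - f1 s j * lossF η0 (f1 s)

noncomputable def rhs2 {n : ℕ} (v : Fin n → ℝ) (η0 : ℝ) (A : Fin n → Fin n → Fin n → ℝ → ℝ)
    (Φ : ℝ → ℝ → ℝ) (a : ℝ) (Φbar2 : ℝ → ℝ) (f1 f2 : ℝ → Fin n → ℝ) (j : Fin n) (s : ℝ) : ℝ :=
  v j * (a * Φ (a * ∑ k, deltaC k * f1 s k) (rhoF (f2 s)) * f1 s j * deltaC j
    - Φbar2 s * f2 s j)
  + gainF η0 A j (f2 s) - f2 s j * lossF η0 (f2 s)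

noncomputable def rhs3 {n : ℕ} (v : Fin n → ℝ) (η0 : ℝ) (A : Fin n → Fin n → Fin n → ℝ → ℝ)
    (Φ : ℝ → ℝ → ℝ) (a : ℝ) (Φbar3 : ℝ → ℝ) (f1 f3 : ℝ → Fin n → ℝ) (j : Fin n) (s : ℝ) : ℝ :=
  v j * ((1 - a) * Φ ((1 - a) * ∑ k, deltaC k * f1 s k) (rhoF (f3 s)) * f1 s j * deltaC j
    - Φbar3 s * f3 s j)
  + gainF η0 A j (f3 s) - f3 s j * lossF η0 (f3 s)

def IsMildSol12 {n : ℕ} (v : Fin n → ℝ) (η0 : ℝ) (A : Fin n → Fin n → Fin n → ℝ → ℝ)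
    (Φ : ℝ → ℝ → ℝ) (a T : ℝ) (φ1 φ2 φ3 : Fin n → ℝ)
    (fbar1 : ℝ → Fin n → ℝ) (Φbar2 Φbar3 : ℝ → ℝ) (f1 f2 f3 : ℝ → Fin n → ℝ) : Prop :=
  ContinuousOn f1 (Icc 0 T) ∧ ContinuousOn f2 (Icc 0 T) ∧ ContinuousOn f3 (Icc 0 T) ∧
  (∀ t ∈ Icc (0:ℝ) T, admissibleF (f1 t) ∧ admissibleF (f2 t) ∧ admissibleF (f3 t)) ∧
  (∀ t ∈ Icc (0:ℝ) T, ∀ j : Fin n,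
    f1 t j = φ1 j + ∫ s in (0:ℝ)..t, rhs1 v η0 A Φ a fbar1 f1 f2 f3 j s) ∧
  (∀ t ∈ Icc (0:ℝ) T, ∀ j : Fin n,
    f2 t j = φ2 j + ∫ s in (0:ℝ)..t, rhs2 v η0 A Φ a Φbar2 f1 f2 j s) ∧
  (∀ t ∈ Icc (0:ℝ) T, ∀ j : Fin n,
    f3 t j = φ3 j + ∫ s in (0:ℝ)..t, rhs3 v η0 A Φ a Φbar3 f1 f3 j s)

def GoodData12 {n : ℕ} (T : ℝ) (φ1 φ2 φ3 : Fin n → ℝ) (fbar1 : ℝ → Fin n → ℝ)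
    (Φbar2 Φbar3 : ℝ → ℝ) : Prop :=
  admissibleF φ1 ∧ admissibleF φ2 ∧ admissibleF φ3 ∧
  ContinuousOn fbar1 (Icc 0 T) ∧ (∀ t ∈ Icc (0:ℝ) T, admissibleF (fbar1 t)) ∧
  ContinuousOn Φbar2 (Icc 0 T) ∧ (∀ t ∈ Icc (0:ℝ) T, Φbar2 t ∈ Icc (0:ℝ) 1) ∧
  ContinuousOn Φbar3 (Icc 0 T) ∧ (∀ t ∈ Icc (0:ℝ) T, Φbar3 t ∈ Icc (0:ℝ) 1)

/-! ### Bounded time-dependent fields that are Lipschitz in the state -/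

/-- A time-dependent field which is jointly continuous, bounded, and Lipschitz in the state
variable, uniformly for times in `[0, T]`. -/
structure BddLip {E F : Type*} [NormedAddCommGroup E] [NormedAddCommGroup F] (T : ℝ)
    (g : ℝ → E → F) : Prop where
  cont : ContinuousOn (fun p : ℝ × E => g p.1 p.2) (Icc 0 T ×ˢ univ)
  bdd : ∃ C, 0 ≤ C ∧ ∀ t ∈ Icc 0 T, ∀ x, ‖g t x‖ ≤ C
  lip : ∃ L, 0 ≤ L ∧ ∀ t ∈ Icc 0 T, ∀ x y, ‖g t x - g t y‖ ≤ L * ‖x - y‖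

namespace BddLip

variable {E F : Type*} [NormedAddCommGroup E] [NormedAddCommGroup F] {T : ℝ}

theorem of_time {c : ℝ → F} (hc : ContinuousOn c (Icc 0 T)) :
    BddLip T (fun t (_ : E) => c t) where
  cont := hc.comp continuousOn_fst fun _ hp => hp.1
  bdd := by
    obtain ⟨C, hC⟩ := isCompact_Icc.exists_bound_of_continuousOn hc
    exact ⟨max C 0, le_max_right _ _, fun t ht _ => (hC t ht).trans (le_max_left _ _)⟩
  lip := ⟨0, le_rfl, fun t _ x y => by simp⟩

theorem const (c : F) : BddLip T (fun _ (_ : E) => c) := of_time continuousOn_const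

theorem add {g h : ℝ → E → F} (hg : BddLip T g) (hh : BddLip T h) :
    BddLip T (fun t x => g t x + h t x) where
  cont := hg.cont.add hh.cont
  bdd := by
    obtain ⟨C, hC, hgC⟩ := hg.bdd
    obtain ⟨D, hD, hhD⟩ := hh.bdd
    exact ⟨C + D, by positivity, fun t ht x => norm_add_le_of_le (hgC t ht x) (hhD t ht x)⟩
  lip := by
    obtain ⟨C, hC, hgC⟩ := hg.lip
    obtain ⟨D, hD, hhD⟩ := hh.lip
    refine ⟨C + D, by positivity, fun t ht x y => ?_⟩
    rw [add_sub_add_comm, add_mul]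
    exact norm_add_le_of_le (hgC t ht x y) (hhD t ht x y)

theorem mul {g h : ℝ → E → ℝ} (hg : BddLip T g) (hh : BddLip T h) :
    BddLip T (fun t x => g t x * h t x) where
  cont := hg.cont.mul hh.cont
  bdd := by
    obtain ⟨C, hC, hgC⟩ := hg.bdd
    obtain ⟨D, hD, hhD⟩ := hh.bdd
    exact ⟨C * D, by positivity, fun t ht x => norm_mul_le_of_le (hgC t ht x) (hhD t ht x)⟩
  lip := by
    obtain ⟨C, hC, hgC⟩ := hg.bdd
    obtain ⟨D, hD, hhD⟩ := hh.bdd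
    obtain ⟨C', hC', hgC'⟩ := hg.lip
    obtain ⟨D', hD', hhD'⟩ := hh.lip
    refine ⟨C * D' + C' * D, by positivity, fun t ht x y => ?_⟩
    have hsplit : g t x * h t x - g t y * h t y =
        g t x * (h t x - h t y) + (g t x - g t y) * h t y := by ring
    rw [hsplit]
    calc _ ≤ C * (D' * ‖x - y‖) + (C' * ‖x - y‖) * D :=
          norm_add_le_of_le (norm_mul_le_of_le (hgC t ht x) (hhD' t ht x y))
            (norm_mul_le_of_le (hgC' t ht x y) (hhD t ht y))
      _ = _ := by ring

theorem sub {g h : ℝ → E → ℝ} (hg : BddLip T g) (hh : BddLip T h) :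
    BddLip T (fun t x => g t x - h t x) := by
  simpa [sub_eq_add_neg] using hg.add ((const (-1)).mul hh)

theorem sum {ι : Type*} (s : Finset ι) {g : ι → ℝ → E → F} (hg : ∀ i, BddLip T (g i)) :
    BddLip T (fun t x => ∑ i ∈ s, g i t x) := by
  classical
  induction s using Finset.induction_on with
  | empty => simpa using const (E := E) (0 : F)
  | insert i s his ih =>
    simp only [Finset.sum_insert his]
    exact (hg i).add ih

theorem pi {ι : Type*} [Fintype ι] {g : ℝ → E → ι → F}
    (hg : ∀ i, BddLip T (fun t x => g t x i)) : BddLip T g where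
  cont := continuousOn_pi.2 fun i => (hg i).cont
  bdd := by
    choose C hC hgC using fun i => (hg i).bdd
    refine ⟨∑ i, C i, Finset.sum_nonneg fun i _ => hC i, fun t ht x => ?_⟩
    refine (pi_norm_le_iff_of_nonneg (Finset.sum_nonneg fun i _ => hC i)).2 fun i => ?_
    exact (hgC i t ht x).trans
      (Finset.single_le_sum (fun i _ => hC i) (Finset.mem_univ i))
  lip := by
    choose C hC hgC using fun i => (hg i).lip
    refine ⟨∑ i, C i, Finset.sum_nonneg fun i _ => hC i, fun t ht x y => ?_⟩
    refine (pi_norm_le_iff_of_nonneg (mul_nonneg (Finset.sum_nonneg fun i _ => hC i)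
      (norm_nonneg _))).2 fun i => ?_
    exact (hgC i t ht x y).trans (mul_le_mul_of_nonneg_right
      (Finset.single_le_sum (fun i _ => hC i) (Finset.mem_univ i)) (norm_nonneg _))

theorem comp₂ {Ψ : ℝ → ℝ → ℝ}
    (hΨ : ∀ u ∈ Icc (0:ℝ) 1, ∀ w ∈ Icc (0:ℝ) 1, Ψ u w ∈ Icc (0:ℝ) 1) {K : ℝ} (hK : 0 < K)
    (hΨK : ∀ u₁ ∈ Icc (0:ℝ) 1, ∀ w₁ ∈ Icc (0:ℝ) 1, ∀ u₂ ∈ Icc (0:ℝ) 1, ∀ w₂ ∈ Icc (0:ℝ) 1,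
      |Ψ u₂ w₂ - Ψ u₁ w₁| ≤ K * (|u₂ - u₁| + |w₂ - w₁|))
    {g h : ℝ → E → ℝ} (hg : BddLip T g) (hh : BddLip T h)
    (hg1 : ∀ t ∈ Icc 0 T, ∀ x, g t x ∈ Icc (0:ℝ) 1)
    (hh1 : ∀ t ∈ Icc 0 T, ∀ x, h t x ∈ Icc (0:ℝ) 1) :
    BddLip T (fun t x => Ψ (g t x) (h t x)) where
  cont := by
    have hcont : ContinuousOn (fun q : ℝ × ℝ => Ψ q.1 q.2) (Icc 0 1 ×ˢ Icc 0 1) := by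
      refine LipschitzOnWith.continuousOn (K := (2 * K).toNNReal)
        (LipschitzOnWith.of_dist_le_mul fun p hp q hq => ?_)
      rw [Real.coe_toNNReal _ (by positivity), Real.dist_eq]
      refine (hΨK _ hq.1 _ hq.2 _ hp.1 _ hp.2).trans ?_
      have h1 : |p.1 - q.1| ≤ dist p q := by
        rw [← Real.dist_eq]; exact le_max_left _ _
      have h2 : |p.2 - q.2| ≤ dist p q := by
        rw [← Real.dist_eq]; exact le_max_right _ _
      nlinarith
    exact hcont.comp (hg.cont.prodMk hh.cont) fun p hp => ⟨hg1 _ hp.1 _, hh1 _ hp.1 _⟩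
  bdd := by
    refine ⟨1, zero_le_one, fun t ht x => ?_⟩
    have := hΨ _ (hg1 t ht x) _ (hh1 t ht x)
    rw [Real.norm_eq_abs, abs_of_nonneg this.1]
    exact this.2
  lip := by
    obtain ⟨C, hC, hgC⟩ := hg.lip
    obtain ⟨D, hD, hhD⟩ := hh.lip
    refine ⟨K * (C + D), by positivity, fun t ht x y => ?_⟩
    refine (hΨK _ (hg1 t ht y) _ (hh1 t ht y) _ (hg1 t ht x) _ (hh1 t ht x)).trans ?_
    rw [mul_assoc, add_mul]
    exact mul_le_mul_of_nonneg_left (add_le_add (hgC t ht x y) (hhD t ht x y)) hK.le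

theorem comp_continuousOn {g : ℝ → E → F} (hg : BddLip T g) {x : ℝ → E}
    (hx : ContinuousOn x (Icc 0 T)) : ContinuousOn (fun t => g t (x t)) (Icc 0 T) :=
  hg.cont.comp (continuousOn_id.prodMk hx) fun _ ht => ⟨ht, mem_univ _⟩

end BddLip

/-! ### Relaxation towards a bounded field -/

/-- The relaxation equation `x' = c (P(t, x) - x)` is solvable on all of `[0, T]`. -/
theorem BddLip.exists_relaxation {E : Type*} [NormedAddCommGroup E] [NormedSpace ℝ E]
    [CompleteSpace E] {T : ℝ} (hT : 0 < T) {P : ℝ → E → E} (hP : BddLip T P) {c : ℝ} (hc : 0 < c)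
    (x₀ : E) :
    ∃ x : ℝ → E, x 0 = x₀ ∧
      ∀ t ∈ Icc 0 T, HasDerivWithinAt x (c • (P t (x t) - x t)) (Icc 0 T) t := by
  obtain ⟨M, hM, hPM⟩ := hP.bdd
  obtain ⟨L, hL, hPL⟩ := hP.lip
  have hcont : Continuous fun t : ℝ => c * Real.exp (c * t) := by fun_prop
  have hcont' : Continuous fun t : ℝ => Real.exp (-(c * t)) := by fun_prop
  set W : ℝ := c * Real.exp (c * T) with hW
  have hW0 : 0 ≤ W := by positivity
  have hexp : ∀ t ∈ Icc 0 T, c * Real.exp (c * t) ≤ W := fun t ht => by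
    have := ht.2
    rw [hW]; gcongr
  have hPL' : IsPicardLindelof (fun t y => (c * Real.exp (c * t)) • P t (Real.exp (-(c * t)) • y))
      (tmin := 0) (tmax := T) ⟨0, left_mem_Icc.2 hT.le⟩ x₀ (W * M * T).toNNReal 0
      (W * M).toNNReal (W * L).toNNReal := by
    refine ⟨fun t ht => ?_, fun y _ => ?_, fun t ht y _ => ?_, ?_⟩
    · refine LipschitzOnWith.of_dist_le_mul fun y _ z _ => ?_
      rw [Real.coe_toNNReal _ (by positivity), dist_eq_norm, dist_eq_norm, ← smul_sub, norm_smul,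
        Real.norm_of_nonneg (by positivity), mul_assoc W]
      refine mul_le_mul (hexp t ht) ((hPL t ht _ _).trans ?_) (norm_nonneg _) hW0
      rw [← smul_sub, norm_smul, Real.norm_of_nonneg (by positivity)]
      refine mul_le_mul_of_nonneg_left ?_ hL
      refine mul_le_of_le_one_left (norm_nonneg _) (Real.exp_le_one_iff.2 ?_)
      have := mul_nonneg hc.le ht.1
      linarith
    · exact hcont.continuousOn.smul
        (hP.comp_continuousOn (hcont'.continuousOn.smul continuousOn_const))
    · rw [Real.coe_toNNReal _ (by positivity), norm_smul, Real.norm_of_nonneg (by positivity)]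
      exact mul_le_mul (hexp t ht) (hPM t ht _) (norm_nonneg _) hW0
    · rw [Real.coe_toNNReal _ (by positivity), Real.coe_toNNReal _ (by positivity)]
      simp [hT.le]
  obtain ⟨y, hy0, hy⟩ := hPL'.exists_eq_forall_mem_Icc_hasDerivWithinAt₀
  refine ⟨fun t => Real.exp (-(c * t)) • y t, by simpa using hy0, fun t ht => ?_⟩
  have he : HasDerivWithinAt (fun t => Real.exp (-(c * t))) (Real.exp (-(c * t)) * (-c))
      (Icc 0 T) t := by
    have := (((hasDerivAt_id t).const_mul c).neg).exp
    simpa using this.hasDerivWithinAt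
  refine (he.smul (hy t ht)).congr_deriv ?_
  rw [smul_smul, smul_sub, smul_smul, sub_eq_add_neg, ← neg_smul]
  congr 2
  · rw [mul_left_comm, ← Real.exp_add]
    simp
  · ring

/-- A real quantity relaxing towards values `≤ b` stays `≤ b`. -/
theorem relaxation_le {T c b : ℝ} (hc : 0 < c) {z p : ℝ → ℝ}
    (hz : ∀ t ∈ Icc 0 T, HasDerivWithinAt z (c * (p t - z t)) (Icc 0 T) t)
    (hp : ∀ t ∈ Icc 0 T, p t ≤ b) (h0 : z 0 ≤ b) : ∀ t ∈ Icc 0 T, z t ≤ b := by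
  intro t ht
  have hw : ∀ s ∈ Icc 0 T, HasDerivWithinAt (fun s => Real.exp (c * s) * (z s - b))
      (c * Real.exp (c * s) * (p s - b)) (Icc 0 T) s := fun s hs => by
    have he : HasDerivWithinAt (fun s => Real.exp (c * s)) (Real.exp (c * s) * c) (Icc 0 T) s := by
      simpa using (((hasDerivAt_id s).const_mul c).exp).hasDerivWithinAt
    refine (he.mul ((hz s hs).sub_const b)).congr_deriv ?_
    ring
  have hanti : AntitoneOn (fun s => Real.exp (c * s) * (z s - b)) (Icc 0 T) := by
    have hderiv : ∀ s ∈ interior (Icc 0 T), HasDerivAt (fun s => Real.exp (c * s) * (z s - b))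
        (c * Real.exp (c * s) * (p s - b)) s := fun s hs =>
      (hw s (interior_subset hs)).hasDerivAt (mem_interior_iff_mem_nhds.1 hs)
    refine antitoneOn_of_deriv_nonpos (convex_Icc 0 T) (fun s hs => (hw s hs).continuousWithinAt)
      (fun s hs => (hderiv s hs).differentiableAt.differentiableWithinAt) fun s hs => ?_
    rw [(hderiv s hs).deriv]
    exact mul_nonpos_of_nonneg_of_nonpos (by positivity)
      (sub_nonpos.2 (hp s (interior_subset hs)))
  have h := hanti ⟨le_rfl, ht.1.trans ht.2⟩ ht ht.1
  simp only [mul_zero, Real.exp_zero, one_mul] at h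
  have := Real.exp_pos (c * t)
  by_contra! hlt
  nlinarith

/-! ### Retraction onto the admissible states -/

theorem admissibleF_iff {n : ℕ} {f : Fin n → ℝ} :
    admissibleF f ↔ (∀ j, 0 ≤ f j) ∧ ∑ j, f j ≤ 1 := by
  refine ⟨fun h => ⟨fun j => (h.1 j).1, h.2⟩, fun h => ⟨fun j => ⟨h.1 j, ?_⟩, h.2⟩⟩
  exact (Finset.single_le_sum (fun i _ => h.1 i) (Finset.mem_univ j)).trans h.2

theorem admissibleF.rhoF_mem {n : ℕ} {f : Fin n → ℝ} (hf : admissibleF f) :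
    rhoF f ∈ Icc (0:ℝ) 1 :=
  ⟨Finset.sum_nonneg fun j _ => (hf.1 j).1, hf.2⟩

/-- Truncate the negative parts and renormalise the density to at most one. -/
noncomputable def retractB {n : ℕ} (f : Fin n → ℝ) (j : Fin n) : ℝ :=
  max (f j) 0 / max 1 (∑ k, max (f k) 0)

theorem retractB_admissible {n : ℕ} (f : Fin n → ℝ) : admissibleF (retractB f) := by
  have hm : 0 < max 1 (∑ k, max (f k) 0) := lt_max_of_lt_left one_pos
  refine admissibleF_iff.2 ⟨fun j => div_nonneg (le_max_right _ _) hm.le, ?_⟩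
  simp only [retractB]
  rw [← Finset.sum_div, div_le_one hm]
  exact le_max_right _ _

theorem retractB_of_admissible {n : ℕ} {f : Fin n → ℝ} (hf : admissibleF f) : retractB f = f := by
  ext j
  have hpos : ∀ k, max (f k) 0 = f k := fun k => max_eq_left (hf.1 k).1
  have hsum : ∑ k, f k ≤ 1 := hf.2
  simp [retractB, hpos, hsum]

theorem abs_div_sub_div_le {u u' m m' : ℝ} (hm : 1 ≤ m) (hm' : 1 ≤ m') (hu : 0 ≤ u')
    (hum : u' ≤ m') : |u / m - u' / m'| ≤ |u - u'| + |m - m'| := by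
  have hm0 : 0 < m := by linarith
  have hm0' : 0 < m' := by linarith
  have hsplit : u / m - u' / m' = (u - u') / m + u' / m' * ((m' - m) / m) := by
    field_simp; ring
  rw [hsplit]
  refine (abs_add_le _ _).trans (add_le_add ?_ ?_)
  · rw [abs_div, abs_of_pos hm0]
    exact div_le_self (abs_nonneg _) hm
  · rw [abs_mul, abs_div (m' - m), abs_of_pos hm0, abs_of_nonneg (by positivity), abs_sub_comm m' m]
    exact (mul_le_of_le_one_left (by positivity) ((div_le_one hm0').2 hum)).trans
      (div_le_self (abs_nonneg _) hm)

theorem bddLip_retractB {n : ℕ} {ι : Type*} [Fintype ι] (T : ℝ) (i : ι) (j : Fin n) :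
    BddLip T (fun _ (x : ι → Fin n → ℝ) => retractB (x i) j) where
  cont := by
    unfold retractB
    refine Continuous.continuousOn (Continuous.div (by fun_prop) (by fun_prop) fun p => ?_)
    exact (lt_max_of_lt_left one_pos).ne'
  bdd := ⟨1, zero_le_one, fun t _ x => by
    have := (retractB_admissible (x i)).1 j
    rw [Real.norm_of_nonneg this.1]
    exact this.2⟩
  lip := by
    refine ⟨1 + n, by positivity, fun t _ x y => ?_⟩
    have hcoord : ∀ k, |max (x i k) 0 - max (y i k) 0| ≤ ‖x - y‖ := fun k =>
      (abs_max_sub_max_le_abs _ _ _).trans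
        ((norm_le_pi_norm ((x - y) i) k).trans (norm_le_pi_norm (x - y) i))
    refine (abs_div_sub_div_le (le_max_left _ _) (le_max_left _ _) (le_max_right _ _)
      ((Finset.single_le_sum (f := fun k => max (y i k) 0) (fun k _ => le_max_right _ _)
        (Finset.mem_univ j)).trans (le_max_right _ _))).trans ?_
    rw [add_mul, one_mul]
    refine add_le_add (hcoord j) ?_
    rw [max_comm 1, max_comm 1]
    refine (abs_max_sub_max_le_abs _ _ _).trans ?_
    rw [← Finset.sum_sub_distrib]
    refine (Finset.abs_sum_le_sum_abs _ _).trans ?_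
    simpa using Finset.sum_le_sum fun k (_ : k ∈ Finset.univ) => hcoord k

/-! ### The junction vector field -/

theorem IsFluxLimiter.mul_le {Φ : ℝ → ℝ → ℝ} (hΦ : IsFluxLimiter Φ) {u w : ℝ}
    (hu : u ∈ Icc (0:ℝ) 1) (hw : w ∈ Icc (0:ℝ) 1) : Φ u w * u ≤ 1 - w := by
  by_cases h : 1 < u + w
  · exact hΦ.2.1 u hu w hw h
  · have := mul_le_of_le_one_left hu.1 (hΦ.1 u hu w hw).2
    linarith

theorem IsFluxLimiter.bddLip {E : Type*} [NormedAddCommGroup E] {T : ℝ} {Φ : ℝ → ℝ → ℝ}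
    (hΦ : IsFluxLimiter Φ) {g h : ℝ → E → ℝ} (hg : BddLip T g) (hh : BddLip T h)
    (hg1 : ∀ t ∈ Icc 0 T, ∀ x, g t x ∈ Icc (0:ℝ) 1)
    (hh1 : ∀ t ∈ Icc 0 T, ∀ x, h t x ∈ Icc (0:ℝ) 1) :
    BddLip T (fun t x => Φ (g t x) (h t x)) := by
  obtain ⟨hΦ1, -, K, hK, hΦK⟩ := hΦ
  exact BddLip.comp₂ hΦ1 hK hΦK hg hh hg1 hh1

theorem IsSpeedLattice.mem_Icc {n : ℕ} {hn : 2 ≤ n} {v : Fin n → ℝ} (hv : IsSpeedLattice hn v)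
    (j : Fin n) : v j ∈ Icc (0:ℝ) 1 := by
  obtain ⟨hmono, h0, h1⟩ := hv
  refine ⟨h0 ▸ hmono.monotone ?_, h1 ▸ hmono.monotone ?_⟩
  · exact Fin.le_def.2 (Nat.zero_le _)
  · exact Fin.le_def.2 (Nat.le_sub_one_of_lt j.2)

theorem deltaC_mem_Icc {n : ℕ} (j : Fin n) : (deltaC j : ℝ) ∈ Icc (0:ℝ) 1 := by
  unfold deltaC
  split_ifs <;> simp

theorem admissibleF.mul_sum_deltaC_mem {n : ℕ} {f : Fin n → ℝ} (hf : admissibleF f) {a : ℝ}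
    (ha : a ∈ Icc (0:ℝ) 1) : a * ∑ k, deltaC k * f k ∈ Icc (0:ℝ) 1 := by
  have h0 : 0 ≤ ∑ k, deltaC k * f k :=
    Finset.sum_nonneg fun k _ => mul_nonneg (deltaC_mem_Icc k).1 (hf.1 k).1
  have h1 : ∑ k, deltaC k * f k ≤ 1 :=
    (Finset.sum_le_sum fun k _ =>
      mul_le_of_le_one_left (hf.1 k).1 (deltaC_mem_Icc k).2).trans hf.2
  exact ⟨mul_nonneg ha.1 h0, mul_le_one₀ ha.2 h0 h1⟩

section Fields

variable {n : ℕ} {E : Type*} [NormedAddCommGroup E] {T η0 a : ℝ} {v : Fin n → ℝ}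
  {A : Fin n → Fin n → Fin n → ℝ → ℝ} {Φ : ℝ → ℝ → ℝ} {b b1 b2 b3 : E → Fin n → ℝ}
  {fbar1 : ℝ → Fin n → ℝ} {Φbar : ℝ → ℝ}

theorem bddLip_rhoF (hb : ∀ j, BddLip T (fun _ x => b x j)) : BddLip T (fun _ x => rhoF (b x)) :=
  BddLip.sum _ hb

theorem bddLip_gainF (hA : IsTableOfGames A) (hb : ∀ j, BddLip T (fun _ x => b x j))
    (hadm : ∀ x, admissibleF (b x)) (j : Fin n) : BddLip T (fun _ x => gainF η0 A j (b x)) := by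
  have hA' : ∀ h k, BddLip T (fun _ x => A h k j (rhoF (b x))) := fun h k => by
    obtain ⟨K, hK, hAK⟩ := hA.2.2 h k j
    refine BddLip.comp₂ (Ψ := fun u _ => A h k j u) (fun u hu _ _ => hA.1 h k j u hu) hK
      (fun u₁ hu₁ w₁ _ u₂ hu₂ w₂ _ => (hAK u₂ hu₂ u₁ hu₁).trans ?_) (bddLip_rhoF hb)
      (bddLip_rhoF hb) (fun _ _ x => (hadm x).rhoF_mem) fun _ _ x => (hadm x).rhoF_mem
    have := abs_nonneg (w₂ - w₁)
    gcongr
    linarith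
  exact ((BddLip.const η0).mul (bddLip_rhoF hb)).mul
    (BddLip.sum _ fun h => BddLip.sum _ fun k => ((hA' h k).mul (hb h)).mul (hb k))

theorem bddLip_lossF (hb : ∀ j, BddLip T (fun _ x => b x j)) :
    BddLip T (fun _ x => lossF η0 (b x)) := by
  simp only [lossF, pow_two]
  exact (BddLip.const η0).mul ((bddLip_rhoF hb).mul (bddLip_rhoF hb))

theorem bddLip_outflux (hΦ : IsFluxLimiter Φ) (ha : a ∈ Icc (0:ℝ) 1)
    (hb1 : ∀ j, BddLip T (fun _ x => b1 x j)) (hadm1 : ∀ x, admissibleF (b1 x))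
    (hb2 : ∀ j, BddLip T (fun _ x => b2 x j)) (hadm2 : ∀ x, admissibleF (b2 x)) :
    BddLip T (fun _ x => a * Φ (a * ∑ k, deltaC k * b1 x k) (rhoF (b2 x))) :=
  (BddLip.const a).mul (hΦ.bddLip
    ((BddLip.const a).mul (BddLip.sum _ fun k => (BddLip.const (deltaC k)).mul (hb1 k)))
    (bddLip_rhoF hb2) (fun _ _ x => (hadm1 x).mul_sum_deltaC_mem ha)
    fun _ _ x => (hadm2 x).rhoF_mem)

theorem bddLip_rhs1 (hA : IsTableOfGames A) (hΦ : IsFluxLimiter Φ) (ha : a ∈ Icc (0:ℝ) 1)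
    (hfbar : ContinuousOn fbar1 (Icc 0 T)) (hfadm : ∀ t ∈ Icc 0 T, admissibleF (fbar1 t))
    (hb1 : ∀ j, BddLip T (fun _ x => b1 x j)) (hadm1 : ∀ x, admissibleF (b1 x))
    (hb2 : ∀ j, BddLip T (fun _ x => b2 x j)) (hadm2 : ∀ x, admissibleF (b2 x))
    (hb3 : ∀ j, BddLip T (fun _ x => b3 x j)) (hadm3 : ∀ x, admissibleF (b3 x)) (j : Fin n) :
    BddLip T (fun t x =>
      rhs1 v η0 A Φ a fbar1 (fun _ => b1 x) (fun _ => b2 x) (fun _ => b3 x) j t) := by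
  have hf : ∀ k, BddLip T (fun t (_ : E) => fbar1 t k) := fun k =>
    BddLip.of_time (continuousOn_pi.1 hfbar k)
  have ha' : 1 - a ∈ Icc (0:ℝ) 1 := ⟨by linarith [ha.2], by linarith [ha.1]⟩
  have hin := hΦ.bddLip (BddLip.sum Finset.univ hf) (bddLip_rhoF hb1)
    (fun t ht _ => (hfadm t ht).rhoF_mem) fun _ _ x => (hadm1 x).rhoF_mem
  exact (((BddLip.const (v j)).mul ((hin.mul (hf j)).sub
    (((bddLip_outflux hΦ ha hb1 hadm1 hb2 hadm2).add
      (bddLip_outflux hΦ ha' hb1 hadm1 hb3 hadm3)).mul (hb1 j)))).add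
    (bddLip_gainF hA hb1 hadm1 j)).sub ((hb1 j).mul (bddLip_lossF hb1))

theorem bddLip_rhs2 (hA : IsTableOfGames A) (hΦ : IsFluxLimiter Φ) (ha : a ∈ Icc (0:ℝ) 1)
    (hΦbar : ContinuousOn Φbar (Icc 0 T))
    (hb1 : ∀ j, BddLip T (fun _ x => b1 x j)) (hadm1 : ∀ x, admissibleF (b1 x))
    (hb2 : ∀ j, BddLip T (fun _ x => b2 x j)) (hadm2 : ∀ x, admissibleF (b2 x)) (j : Fin n) :
    BddLip T (fun t x => rhs2 v η0 A Φ a Φbar (fun _ => b1 x) (fun _ => b2 x) j t) :=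
  (((BddLip.const (v j)).mul ((((bddLip_outflux hΦ ha hb1 hadm1 hb2 hadm2).mul (hb1 j)).mul
    (BddLip.const (deltaC j))).sub ((BddLip.of_time hΦbar).mul (hb2 j)))).add
    (bddLip_gainF hA hb2 hadm2 j)).sub ((hb2 j).mul (bddLip_lossF hb2))

end Fields

theorem rhs3_eq_rhs2 {n : ℕ} (v : Fin n → ℝ) (η0 : ℝ) (A : Fin n → Fin n → Fin n → ℝ → ℝ)
    (Φ : ℝ → ℝ → ℝ) (a : ℝ) (Φbar : ℝ → ℝ) (f1 f3 : ℝ → Fin n → ℝ) (j : Fin n) (s : ℝ) :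
    rhs3 v η0 A Φ a Φbar f1 f3 j s = rhs2 v η0 A Φ (1 - a) Φbar f1 f3 j s := rfl

/-! ### Small Euler steps preserve admissibility -/

section Steps

variable {n : ℕ} {η0 a : ℝ} {v : Fin n → ℝ} {A : Fin n → Fin n → Fin n → ℝ → ℝ}
  {Φ : ℝ → ℝ → ℝ} {f f1 f2 f3 : Fin n → ℝ}

theorem gainF_nonneg (hη0 : 0 < η0) (hA : IsTableOfGames A) (hf : admissibleF f) (j : Fin n) :
    0 ≤ gainF η0 A j f := by
  refine mul_nonneg (mul_nonneg hη0.le hf.rhoF_mem.1) (Finset.sum_nonneg fun h _ =>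
    Finset.sum_nonneg fun k _ => mul_nonneg (mul_nonneg ?_ (hf.1 h).1) (hf.1 k).1)
  exact (hA.1 h k j _ hf.rhoF_mem).1

theorem sum_gainF (hA : IsTableOfGames A) (hf : admissibleF f) :
    ∑ j, gainF η0 A j f = rhoF f * lossF η0 f := by
  have hsum : ∑ j, ∑ h, ∑ k, A h k j (rhoF f) * f h * f k = rhoF f ^ 2 := by
    rw [Finset.sum_comm, rhoF, pow_two, Finset.sum_mul_sum]
    refine Finset.sum_congr rfl fun h _ => ?_
    rw [Finset.sum_comm]
    refine Finset.sum_congr rfl fun k _ => ?_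
    rw [← Finset.sum_mul, ← Finset.sum_mul, hA.2.1 h k (∑ j, f j) hf.rhoF_mem, one_mul]
  simp only [gainF, lossF]
  rw [← Finset.mul_sum, hsum]
  ring

theorem admissibleF.add_step (hη0 : 0 < η0) (hA : IsTableOfGames A) (hf : admissibleF f)
    {I c : Fin n → ℝ} (hI : ∀ j, 0 ≤ I j) (hIsum : ∑ j, I j ≤ 1 - rhoF f)
    (hc : ∀ j, c j ∈ Icc (0:ℝ) 1) :
    admissibleF fun j =>
      f j + (1 + η0)⁻¹ * (I j - c j * f j + gainF η0 A j f - f j * lossF η0 f) := by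
  have hh : 0 < (1 + η0)⁻¹ := by positivity
  have hh1 : (1 + η0)⁻¹ ≤ 1 := inv_le_one_of_one_le₀ (by linarith)
  have hh2 : (1 + η0)⁻¹ * (1 + η0) = 1 := inv_mul_cancel₀ (by positivity)
  set h := (1 + η0)⁻¹
  obtain ⟨hρ0, hρ1⟩ := hf.rhoF_mem
  refine admissibleF_iff.2 ⟨fun j => ?_, ?_⟩
  · have hG := gainF_nonneg hη0 hA hf j
    have hL : lossF η0 f ≤ η0 := mul_le_of_le_one_right hη0.le (pow_le_one₀ hρ0 hρ1)
    have hfj := (hf.1 j).1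
    have hout : (c j + lossF η0 f) * f j ≤ (1 + η0) * f j :=
      mul_le_mul_of_nonneg_right (add_le_add (hc j).2 hL) hfj
    have hsplit : f j + h * (I j - c j * f j + gainF η0 A j f - f j * lossF η0 f) =
        h * (1 + η0) * f j + h * (I j - c j * f j + gainF η0 A j f - f j * lossF η0 f) := by
      rw [hh2, one_mul]
    rw [hsplit]
    have : 0 ≤ h * (((1 + η0) * f j - (c j + lossF η0 f) * f j) + I j + gainF η0 A j f) :=
      mul_nonneg hh.le (by linarith [hI j])
    linarith
  · have hsum : ∑ j, (f j + h * (I j - c j * f j + gainF η0 A j f - f j * lossF η0 f)) =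
        rhoF f + h * (∑ j, I j - ∑ j, c j * f j) := by
      rw [Finset.sum_add_distrib, ← Finset.mul_sum, Finset.sum_sub_distrib,
        Finset.sum_add_distrib, Finset.sum_sub_distrib, sum_gainF hA hf, ← Finset.sum_mul]
      simp only [rhoF]
      ring
    have hcf : 0 ≤ ∑ j, c j * f j :=
      Finset.sum_nonneg fun j _ => mul_nonneg (hc j).1 (hf.1 j).1
    rw [hsum]
    have hstep : h * (∑ j, I j - ∑ j, c j * f j) ≤ h * (1 - rhoF f) :=
      mul_le_mul_of_nonneg_left (by linarith) hh.le
    have : h * (1 - rhoF f) ≤ 1 - rhoF f := mul_le_of_le_one_left (by linarith) hh1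
    linarith

theorem admissibleF.rhs1_step (hη0 : 0 < η0) (hA : IsTableOfGames A) (hΦ : IsFluxLimiter Φ)
    (ha : a ∈ Icc (0:ℝ) 1) (hv : ∀ j, v j ∈ Icc (0:ℝ) 1) (hf1 : admissibleF f1)
    (hf2 : admissibleF f2) (hf3 : admissibleF f3) {fbar1 : ℝ → Fin n → ℝ} {s : ℝ}
    (hfbar : admissibleF (fbar1 s)) :
    admissibleF fun j => f1 j + (1 + η0)⁻¹ *
      rhs1 v η0 A Φ a fbar1 (fun _ => f1) (fun _ => f2) (fun _ => f3) j s := by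
  have ha' : 1 - a ∈ Icc (0:ℝ) 1 := ⟨by linarith [ha.2], by linarith [ha.1]⟩
  have hΦ1 := hΦ.1 _ hfbar.rhoF_mem _ hf1.rhoF_mem
  have hΦ2 := hΦ.1 _ (hf1.mul_sum_deltaC_mem ha) _ hf2.rhoF_mem
  have hΦ3 := hΦ.1 _ (hf1.mul_sum_deltaC_mem ha') _ hf3.rhoF_mem
  convert hf1.add_step hη0 hA
    (I := fun j => v j * (Φ (rhoF (fbar1 s)) (rhoF f1) * fbar1 s j))
    (c := fun j => v j * (a * Φ (a * ∑ k, deltaC k * f1 k) (rhoF f2)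
      + (1 - a) * Φ ((1 - a) * ∑ k, deltaC k * f1 k) (rhoF f3)))
    (fun j => mul_nonneg (hv j).1 (mul_nonneg hΦ1.1 (hfbar.1 j).1)) ?_ (fun j => ?_) using 4
  · simp only [rhs1, rhoF]
    ring
  · refine (Finset.sum_le_sum fun j _ => mul_le_of_le_one_left
      (mul_nonneg hΦ1.1 (hfbar.1 j).1) (hv j).2).trans ?_
    rw [← Finset.mul_sum]
    exact hΦ.mul_le hfbar.rhoF_mem hf1.rhoF_mem
  · have h2 := mul_le_of_le_one_right ha.1 hΦ2.2
    have h3 := mul_le_of_le_one_right ha'.1 hΦ3.2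
    have h20 := mul_nonneg ha.1 hΦ2.1
    have h30 := mul_nonneg ha'.1 hΦ3.1
    exact ⟨mul_nonneg (hv j).1 (by linarith), mul_le_one₀ (hv j).2 (by linarith) (by linarith)⟩

theorem admissibleF.rhs2_step (hη0 : 0 < η0) (hA : IsTableOfGames A) (hΦ : IsFluxLimiter Φ)
    (ha : a ∈ Icc (0:ℝ) 1) (hv : ∀ j, v j ∈ Icc (0:ℝ) 1) (hf1 : admissibleF f1)
    (hf2 : admissibleF f2) {Φbar : ℝ → ℝ} {s : ℝ} (hΦbar : Φbar s ∈ Icc (0:ℝ) 1) :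
    admissibleF fun j => f2 j + (1 + η0)⁻¹ *
      rhs2 v η0 A Φ a Φbar (fun _ => f1) (fun _ => f2) j s := by
  have hu := hf1.mul_sum_deltaC_mem ha
  have hΦ2 := hΦ.1 _ hu _ hf2.rhoF_mem
  have hnonneg : ∀ j, 0 ≤ a * Φ (a * ∑ k, deltaC k * f1 k) (rhoF f2) * f1 j * deltaC j := fun j =>
    mul_nonneg (mul_nonneg (mul_nonneg ha.1 hΦ2.1) (hf1.1 j).1) (deltaC_mem_Icc j).1
  convert hf2.add_step hη0 hA
    (I := fun j => v j * (a * Φ (a * ∑ k, deltaC k * f1 k) (rhoF f2) * f1 j * deltaC j))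
    (c := fun j => v j * Φbar s)
    (fun j => mul_nonneg (hv j).1 (hnonneg j)) ?_ (fun j => ?_) using 4
  · simp only [rhs2]
    ring
  · refine (Finset.sum_le_sum fun j _ => mul_le_of_le_one_left (hnonneg j) (hv j).2).trans ?_
    refine le_trans (le_of_eq ?_) (hΦ.mul_le hu hf2.rhoF_mem)
    simp only [Finset.mul_sum]
    exact Finset.sum_congr rfl fun j _ => by ring
  · exact ⟨mul_nonneg (hv j).1 hΦbar.1, mul_le_one₀ (hv j).2 hΦbar.1 hΦbar.2⟩

end Steps

/-- A field whose Euler steps from admissible states are admissible has an admissible solution. -/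
theorem exists_admissible_solution {n : ℕ} {ι : Type*} [Fintype ι] {T c : ℝ} (hT : 0 < T)
    (hc : 0 < c) {G : ℝ → (ι → Fin n → ℝ) → ι → Fin n → ℝ}
    (hG : ∀ i j, BddLip T fun t (x : ι → Fin n → ℝ) => G t (fun i => retractB (x i)) i j)
    (hstep : ∀ t ∈ Icc 0 T, ∀ x : ι → Fin n → ℝ, (∀ i, admissibleF (x i)) →
      ∀ i, admissibleF fun j => x i j + c⁻¹ * G t x i j)
    (x₀ : ι → Fin n → ℝ) (hx₀ : ∀ i, admissibleF (x₀ i)) :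
    ∃ x : ℝ → ι → Fin n → ℝ, ContinuousOn x (Icc 0 T) ∧
      (∀ t ∈ Icc 0 T, ∀ i, admissibleF (x t i)) ∧
      ∀ t ∈ Icc 0 T, ∀ i j, x t i j = x₀ i j + ∫ s in (0:ℝ)..t, G s (x s) i j := by
  set P : ℝ → (ι → Fin n → ℝ) → ι → Fin n → ℝ := fun t x i j =>
    retractB (x i) j + c⁻¹ * G t (fun i => retractB (x i)) i j with hPdef
  have hP : BddLip T P := BddLip.pi fun i => BddLip.pi fun j =>
    (bddLip_retractB T i j).add ((BddLip.const c⁻¹).mul (hG i j))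
  have hPadm : ∀ t ∈ Icc 0 T, ∀ x i, admissibleF (P t x i) := fun t ht x =>
    hstep t ht (fun i => retractB (x i)) fun i => retractB_admissible (x i)
  obtain ⟨x, hx0, hx⟩ := hP.exists_relaxation hT hc x₀
  have hxij : ∀ t ∈ Icc 0 T, ∀ i j,
      HasDerivWithinAt (fun t => x t i j) (c * (P t (x t) i j - x t i j)) (Icc 0 T) t :=
    fun t ht i j => hasDerivWithinAt_pi.1 (hasDerivWithinAt_pi.1 (hx t ht) i) j
  have hcont : ContinuousOn x (Icc 0 T) := fun t ht => (hx t ht).continuousWithinAt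
  have hadm : ∀ t ∈ Icc 0 T, ∀ i, admissibleF (x t i) := fun t ht i => by
    refine admissibleF_iff.2 ⟨fun j => ?_, ?_⟩
    · refine neg_nonpos.1 (relaxation_le hc (z := fun t => -x t i j)
        (p := fun t => -P t (x t) i j) (fun s hs => ?_) (fun s hs => ?_) ?_ t ht)
      · exact (hxij s hs i j).neg.congr_deriv (by ring)
      · exact neg_nonpos.2 ((hPadm s hs (x s) i).1 j).1
      · simpa [hx0] using ((hx₀ i).1 j).1
    · refine relaxation_le hc (z := fun t => ∑ j, x t i j)
        (p := fun t => ∑ j, P t (x t) i j) (fun s hs => ?_) (fun s hs => ?_) ?_ t ht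
      · refine (HasDerivWithinAt.fun_sum fun j (_ : j ∈ Finset.univ) =>
          hxij s hs i j).congr_deriv ?_
        rw [← Finset.mul_sum, Finset.sum_sub_distrib]
      · exact (hPadm s hs (x s) i).2
      · simpa only [hx0, rhoF] using (hx₀ i).2
  refine ⟨x, hcont, hadm, fun t ht i j => ?_⟩
  have hsub : Icc 0 t ⊆ Icc 0 T := Icc_subset_Icc_right ht.2
  have hret : ∀ s ∈ Icc 0 T, (fun i => retractB (x s i)) = x s := fun s hs =>
    funext fun i => retractB_of_admissible (hadm s hs i)
  have hGcont : ContinuousOn (fun s => G s (x s) i j) (Icc 0 T) :=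
    ((hG i j).comp_continuousOn hcont).congr fun s hs => by simp only [hret s hs]
  have hint := intervalIntegral.integral_eq_sub_of_hasDerivAt_of_le ht.1
    (f := fun s => x s i j) (f' := fun s => G s (x s) i j)
    (fun s hs => (hxij s (hsub hs) i j).continuousWithinAt.mono hsub)
    (fun s hs => ?_)
    ((hGcont.mono hsub).intervalIntegrable_of_Icc ht.1)
  · rw [hint, hx0]
    ring
  · have hs' : s ∈ Icc 0 T := hsub (Ioo_subset_Icc_self hs)
    have hd := (hxij s hs' i j).hasDerivAt (Icc_mem_nhds hs.1 (hs.2.trans_le ht.2))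
    convert hd using 1
    have hri : retractB (x s i) = x s i := retractB_of_admissible (hadm s hs' i)
    simp only [hPdef, hret s hs', hri]
    field_simp
    ring

/-- Existence of a mild kinetic solution across the 1-2 junction. -/
theorem existence_one_two_junction
    {n : ℕ} (hn : 2 ≤ n) (v : Fin n → ℝ) (hv : IsSpeedLattice hn v)
    (η0 : ℝ) (hη0 : 0 < η0)
    (A : Fin n → Fin n → Fin n → ℝ → ℝ) (hA : IsTableOfGames A)
    (Φ : ℝ → ℝ → ℝ) (hΦ : IsFluxLimiter Φ)
    (a T : ℝ) (ha : a ∈ Icc (0:ℝ) 1) (hT : 0 < T)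
    (φ1 φ2 φ3 : Fin n → ℝ) (fbar1 : ℝ → Fin n → ℝ) (Φbar2 Φbar3 : ℝ → ℝ)
    (hdata : GoodData12 T φ1 φ2 φ3 fbar1 Φbar2 Φbar3) :
    ∃ f1 f2 f3 : ℝ → Fin n → ℝ,
      IsMildSol12 v η0 A Φ a T φ1 φ2 φ3 fbar1 Φbar2 Φbar3 f1 f2 f3 := by
  obtain ⟨hφ1, hφ2, hφ3, hfbar, hfadm, hΦ2, hΦ2m, hΦ3, hΦ3m⟩ := hdata
  have ha' : 1 - a ∈ Icc (0:ℝ) 1 := ⟨by linarith [ha.2], by linarith [ha.1]⟩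
  have hv' := hv.mem_Icc
  have hb : ∀ (i : Fin 3) (j : Fin n),
      BddLip T (fun _ (x : Fin 3 → Fin n → ℝ) => retractB (x i) j) := bddLip_retractB T
  have hadm : ∀ (i : Fin 3) (x : Fin 3 → Fin n → ℝ), admissibleF (retractB (x i)) :=
    fun i x => retractB_admissible (x i)
  obtain ⟨x, hcont, hx, hint⟩ := exists_admissible_solution hT (by positivity : 0 < 1 + η0)
    (G := fun t x => ![
      fun j => rhs1 v η0 A Φ a fbar1 (fun _ => x 0) (fun _ => x 1) (fun _ => x 2) j t,
      fun j => rhs2 v η0 A Φ a Φbar2 (fun _ => x 0) (fun _ => x 1) j t,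
      fun j => rhs3 v η0 A Φ a Φbar3 (fun _ => x 0) (fun _ => x 2) j t])
    (fun i j => by
      fin_cases i
      · exact bddLip_rhs1 hA hΦ ha hfbar hfadm (hb 0) (hadm 0) (hb 1) (hadm 1) (hb 2) (hadm 2) j
      · exact bddLip_rhs2 hA hΦ ha hΦ2 (hb 0) (hadm 0) (hb 1) (hadm 1) j
      · exact bddLip_rhs2 hA hΦ ha' hΦ3 (hb 0) (hadm 0) (hb 2) (hadm 2) j)
    (fun t ht x hx i => by
      fin_cases i
      · exact (hx 0).rhs1_step hη0 hA hΦ ha hv' (hx 1) (hx 2) (hfadm t ht)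
      · exact (hx 0).rhs2_step hη0 hA hΦ ha hv' (hx 1) (hΦ2m t ht)
      · exact (hx 0).rhs2_step hη0 hA hΦ ha' hv' (hx 2) (hΦ3m t ht))
    ![φ1, φ2, φ3]
    (fun i => by
      fin_cases i
      · exact hφ1
      · exact hφ2
      · exact hφ3)
  exact ⟨fun t => x t 0, fun t => x t 1, fun t => x t 2, continuousOn_pi.1 hcont 0,
    continuousOn_pi.1 hcont 1, continuousOn_pi.1 hcont 2,
    fun t ht => ⟨hx t ht 0, hx t ht 1, hx t ht 2⟩, fun t ht => hint t ht 0,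
    fun t ht => hint t ht 1, fun t ht => hint t ht 2⟩
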